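/- Let G_n be a sequence of simple bipartite graphs on vertex set [n] whose two partite sets have sizes a_n and n−a_n, such that every vertex in the first part has degree c_n and every vertex in the second part has degree d_n (so a_n·c_n = (n−a_n)·d_n), with a_n/n → p ∈ (0,1) and c_n + d_n → ∞. Let A_n(i,j) = 1{(i,j)∈E_n}/(c_n+d_n), q = 2, J = β·I_2 for a real β with β²·p·(1−p) ≤ 1, and h = 0. Then lim_{n→∞} (1/n)·Φ_n = β·p·(1−p)/2 + log 2. -/

import Mathlib

open Finset Filter Real

noncomputable def pottsH {n q : ℕ} (A : Matrix (Fin n) (Fin n) ℝ)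
    (J : Matrix (Fin q) (Fin q) ℝ) (h : Fin q → ℝ) (y : Fin n → Fin q) : ℝ :=
  (1 / 2) * ∑ i, ∑ j, A i j * J (y i) (y j) + ∑ i, h (y i)

noncomputable def pottsPhi {n q : ℕ} (A : Matrix (Fin n) (Fin n) ℝ)
    (J : Matrix (Fin q) (Fin q) ℝ) (h : Fin q → ℝ) : ℝ :=
  Real.log (∑ y : Fin n → Fin q, Real.exp (pottsH A J h y))

open scoped Classical in
/-- The scaled adjacency matrix of a simple graph: entry `(i,j)` is `c` if `i ∼ j`, else `0`. -/
noncomputable def scaledAdj {n : ℕ} (G : SimpleGraph (Fin n)) (c : ℝ) :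
    Matrix (Fin n) (Fin n) ℝ :=
  fun i j => if G.Adj i j then c else 0

open scoped Classical in
/-- Degree of a vertex in a simple graph on `Fin n`. -/
noncomputable def vertexDegree {n : ℕ} (G : SimpleGraph (Fin n)) (v : Fin n) : ℕ :=
  G.degree v

/-- The `±1` spin attached to a colour. -/
noncomputable def isingSpin (k : Fin 2) : ℝ := if k = 0 then 1 else -1

theorem isingSpin_mul_self (k : Fin 2) : isingSpin k * isingSpin k = 1 := by
  unfold isingSpin; split_ifs <;> norm_num

theorem isingSpin_add_one (k : Fin 2) : isingSpin (k + 1) = -isingSpin k := by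
  fin_cases k <;> simp [isingSpin]

/-- The vector of spins of a configuration. -/
noncomputable def spinVec {n : ℕ} (y : Fin n → Fin 2) : Fin n → ℝ := fun i => isingSpin (y i)

/-- Flip the spin at `i`. -/
def flipAt {n : ℕ} (i : Fin n) (y : Fin n → Fin 2) : Fin n → Fin 2 :=
  Function.update y i (y i + 1)

theorem flipAt_involutive {n : ℕ} (i : Fin n) : Function.Involutive (flipAt i) := by
  intro y
  have h : y i + 1 + 1 = y i := by generalize y i = k; fin_cases k <;> rfl
  simp [flipAt, h]

theorem spinVec_flipAt {n : ℕ} (i : Fin n) (y : Fin n → Fin 2) :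
    spinVec (flipAt i y) = spinVec y - Pi.single i (2 * spinVec y i) := by
  ext j
  by_cases h : j = i
  · subst h
    simp [spinVec, flipAt, isingSpin_add_one]; ring
  · simp [spinVec, flipAt, h]

theorem sum_eq_zero_of_flipAt {n : ℕ} (i : Fin n) (F : (Fin n → Fin 2) → ℝ)
    (h : ∀ y, F (flipAt i y) = -F y) : ∑ y, F y = 0 := by
  have h1 : ∑ y, F (flipAt i y) = ∑ y, F y :=
    Equiv.sum_comp ((flipAt_involutive i).toPerm) F
  simp only [h, Finset.sum_neg_distrib] at h1
  linarith

/-- The energy `½ ⟨s, M s⟩` of a configuration with spin vector `s`. -/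
noncomputable def spinEnergy {n : ℕ} (M : Matrix (Fin n) (Fin n) ℝ) (y : Fin n → Fin 2) : ℝ :=
  (1 / 2) * (spinVec y ⬝ᵥ M.mulVec (spinVec y))

section FlipInvariance

variable {n : ℕ} {M : Matrix (Fin n) (Fin n) ℝ} (i : Fin n) (y : Fin n → Fin 2)

theorem mulVec_spinVec_flipAt (N : Matrix (Fin n) (Fin n) ℝ) :
    N.mulVec (spinVec (flipAt i y)) i = N.mulVec (spinVec y) i - 2 * N i i * spinVec y i := by
  rw [spinVec_flipAt, Matrix.mulVec_sub]
  simp [Matrix.mulVec_single]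
  ring

theorem spinEnergy_flipAt (hM : M.IsSymm) (hd : M i i = 0) :
    spinEnergy M (flipAt i y) =
      spinEnergy M y - 2 * (spinVec y i * M.mulVec (spinVec y) i) := by
  have hs : spinVec y ⬝ᵥ M.mulVec (Pi.single i (2 * spinVec y i))
      = 2 * spinVec y i * M.mulVec (spinVec y) i := by
    rw [Matrix.dotProduct_mulVec, ← Matrix.mulVec_transpose, hM.eq, dotProduct_single]
    ring
  unfold spinEnergy
  rw [spinVec_flipAt, Matrix.mulVec_sub, dotProduct_sub, sub_dotProduct, sub_dotProduct, hs,
    single_dotProduct, single_dotProduct]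
  simp [Matrix.mulVec_single, hd]
  ring

end FlipInvariance

theorem sinh_le_self_mul_cosh {x : ℝ} (hx : 0 ≤ x) : Real.sinh x ≤ x * Real.cosh x := by
  have hm : MonotoneOn (fun x : ℝ => x * Real.cosh x - Real.sinh x) (Set.Ici 0) := by
    apply monotoneOn_of_deriv_nonneg (convex_Ici 0)
    · fun_prop
    · fun_prop
    · intro x hx
      have hx0 : 0 < x := by simpa using hx
      have h : HasDerivAt (fun x : ℝ => x * Real.cosh x - Real.sinh x)
          (1 * Real.cosh x + x * Real.sinh x - Real.cosh x) x :=
        ((hasDerivAt_id x).mul (Real.hasDerivAt_cosh x)).sub (Real.hasDerivAt_sinh x)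
      rw [h.deriv]
      have := mul_nonneg hx0.le (Real.sinh_nonneg_iff.2 hx0.le)
      linarith
  have := hm (Set.mem_Ici.2 le_rfl) (Set.mem_Ici.2 hx) hx
  simp at this
  linarith

theorem tanh_sq_le_sq (x : ℝ) : Real.tanh x ^ 2 ≤ x ^ 2 := by
  have key : ∀ z : ℝ, 0 ≤ z → Real.tanh z ^ 2 ≤ z ^ 2 := by
    intro z hz
    have h0 : 0 ≤ Real.tanh z := by
      rw [Real.tanh_eq_sinh_div_cosh]
      exact div_nonneg (Real.sinh_nonneg_iff.2 hz) (Real.cosh_pos z).le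
    have h1 : Real.tanh z ≤ z := by
      rw [Real.tanh_eq_sinh_div_cosh, div_le_iff₀ (Real.cosh_pos z)]
      exact sinh_le_self_mul_cosh hz
    exact pow_le_pow_left₀ h0 h1 2
  rcases le_total 0 x with h | h
  · exact key x h
  · simpa [Real.tanh_neg] using key (-x) (by linarith)

theorem tanh_sq_le_one (x : ℝ) : Real.tanh x ^ 2 ≤ 1 := by
  rw [Real.tanh_eq_sinh_div_cosh, div_pow, div_le_one (by positivity [Real.cosh_pos x])]
  linarith [Real.cosh_sq x]

/-- Conditioning on all spins but `i` replaces that spin by `tanh` of its local field. -/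
theorem sum_exp_mul_spin_sub_tanh {n : ℕ} {M : Matrix (Fin n) (Fin n) ℝ} (hM : M.IsSymm)
    (hd : ∀ i, M i i = 0) (i : Fin n) (g : (Fin n → Fin 2) → ℝ)
    (hg : ∀ y, g (flipAt i y) = g y) :
    ∑ y, Real.exp (spinEnergy M y) *
      (g y * (spinVec y i - Real.tanh (M.mulVec (spinVec y) i))) = 0 := by
  apply sum_eq_zero_of_flipAt i
  intro y
  rw [hg, mulVec_spinVec_flipAt, spinEnergy_flipAt i y hM (hd i), hd i]
  have hs : spinVec (flipAt i y) i = -spinVec y i := by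
    rw [spinVec_flipAt]; simp; ring
  have h1 := isingSpin_mul_self (y i)
  rw [hs, mul_zero, zero_mul, sub_zero, Real.exp_sub]
  generalize M.mulVec (spinVec y) i = m
  have h2 : spinVec y i = 1 ∨ spinVec y i = -1 := by
    apply mul_self_eq_one_iff.1; exact h1
  have he : Real.exp (2 * m) = Real.exp m * Real.exp m := by rw [← Real.exp_add]; ring_nf
  rw [Real.tanh_eq_sinh_div_cosh, Real.sinh_eq, Real.cosh_eq]
  have hp := Real.exp_pos m
  rcases h2 with h2 | h2 <;> rw [h2]
  · rw [one_mul, he, Real.exp_neg]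
    field_simp
    ring
  · rw [show 2 * (-1 * m) = -(2 * m) by ring, Real.exp_neg, he, Real.exp_neg]
    field_simp
    ring

/-- Up to terms of zero Gibbs expectation, the energy is at most `4 δ n`. -/
theorem spinEnergy_le {n : ℕ} {M : Matrix (Fin n) (Fin n) ℝ} (hM : M.IsSymm) {δ : ℝ}
    (hδ : ∀ i, (M * M) i i ≤ δ)
    (hρ : ∀ v : Fin n → ℝ, ∑ i, M.mulVec v i ^ 2 ≤ (1 / 2) * ∑ i, v i ^ 2)
    (y : Fin n → Fin 2) :
    spinEnergy M y ≤ 4 * δ * n +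
      ∑ i, ((1 / 2) * M.mulVec (spinVec y) i +
          2 * ((M * M).mulVec (spinVec y) i - (M * M) i i * spinVec y i)) *
        (spinVec y i - Real.tanh (M.mulVec (spinVec y) i)) := by
  set s := spinVec y with hs
  set m := M.mulVec s with hm
  have hss : ∀ i, s i * s i = 1 := fun i => isingSpin_mul_self (y i)
  have hD : ∀ i, 0 ≤ (M * M) i i := by
    intro i
    rw [Matrix.mul_apply]
    refine Finset.sum_nonneg fun j _ => ?_
    rw [hM.apply i j]
    exact mul_self_nonneg _
  have hMM : (M * M).mulVec s = M.mulVec m := by rw [hm, Matrix.mulVec_mulVec]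
  have hsum : ∑ i, m i ^ 2 = ∑ i, s i * M.mulVec m i := by
    have h1 : m ⬝ᵥ m = s ⬝ᵥ M.mulVec m := by
      rw [Matrix.dotProduct_mulVec, ← Matrix.mulVec_transpose, hM.eq, dotProduct_comm]
    simpa [dotProduct, pow_two] using h1
  have hE : spinEnergy M y = ∑ i, (1 / 2) * (s i * m i) := by
    rw [← Finset.mul_sum]; rfl
  have hpt : ∀ i, (1 / 2) * (s i * m i) + 2 * (s i * M.mulVec m i) ≤ 4 * δ +
      ((1 / 2) * m i + 2 * ((M * M).mulVec s i - (M * M) i i * s i)) * (s i - Real.tanh (m i))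
      + (3 / 2) * m i ^ 2 + M.mulVec m i ^ 2 := by
    intro i
    rw [hMM]
    have ht1 := tanh_sq_le_sq (m i)
    have ht2 := tanh_sq_le_one (m i)
    have h1 : -(Real.tanh (m i) * s i) ≤ 1 := by
      nlinarith [sq_nonneg (Real.tanh (m i) + s i), hss i]
    have h2 := mul_le_mul_of_nonneg_left h1 (hD i)
    have h3 := hδ i
    have h4 : (M * M) i i * (s i * s i) = (M * M) i i := by rw [hss i, mul_one]
    nlinarith [sq_nonneg (Real.tanh (m i) - m i), sq_nonneg (Real.tanh (m i) - M.mulVec m i)]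
  have hall := Finset.sum_le_sum fun i (_ : i ∈ Finset.univ) => hpt i
  simp only [Finset.sum_add_distrib] at hall
  rw [← hE, ← Finset.mul_sum, ← hsum, ← Finset.mul_sum (a := (3 / 2 : ℝ))] at hall
  have h5 := hρ m
  simp only [Finset.sum_const, Finset.card_univ, Fintype.card_fin, nsmul_eq_mul] at hall
  linarith

theorem sum_spinEnergy {n : ℕ} {M : Matrix (Fin n) (Fin n) ℝ} (hd : ∀ i, M i i = 0) :
    ∑ y, spinEnergy M y = 0 := by
  unfold spinEnergy dotProduct
  rw [← Finset.mul_sum, Finset.sum_comm, Finset.sum_eq_zero, mul_zero]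
  intro i _
  apply sum_eq_zero_of_flipAt i
  intro y
  rw [mulVec_spinVec_flipAt, hd, spinVec_flipAt]
  simp
  ring

theorem two_pow_le_sum_exp_spinEnergy {n : ℕ} {M : Matrix (Fin n) (Fin n) ℝ}
    (hd : ∀ i, M i i = 0) : (2 : ℝ) ^ n ≤ ∑ y, Real.exp (spinEnergy M y) := by
  have h : ∑ y : Fin n → Fin 2, (spinEnergy M y + 1) ≤ ∑ y, Real.exp (spinEnergy M y) :=
    Finset.sum_le_sum fun y _ => Real.add_one_le_exp _
  rw [Finset.sum_add_distrib, sum_spinEnergy hd] at h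
  simpa using h

theorem sum_exp_spinEnergy_le {n : ℕ} {M : Matrix (Fin n) (Fin n) ℝ} (hM : M.IsSymm)
    (hd : ∀ i, M i i = 0) {δ : ℝ} (hδ : ∀ i, (M * M) i i ≤ δ)
    (hρ : ∀ v : Fin n → ℝ, ∑ i, M.mulVec v i ^ 2 ≤ (1 / 2) * ∑ i, v i ^ 2) :
    ∑ y, Real.exp (spinEnergy M y) ≤ 2 ^ n * Real.exp (4 * δ * n) := by
  have hzero : ∑ y, Real.exp (spinEnergy M y) *
      ∑ i, ((1 / 2) * M.mulVec (spinVec y) i +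
          2 * ((M * M).mulVec (spinVec y) i - (M * M) i i * spinVec y i)) *
        (spinVec y i - Real.tanh (M.mulVec (spinVec y) i)) = 0 := by
    simp only [Finset.mul_sum]
    rw [Finset.sum_comm]
    refine Finset.sum_eq_zero fun i _ => ?_
    refine sum_exp_mul_spin_sub_tanh hM hd i (fun y => (1 / 2) * M.mulVec (spinVec y) i +
          2 * ((M * M).mulVec (spinVec y) i - (M * M) i i * spinVec y i)) fun y => ?_
    have hs : spinVec (flipAt i y) i = -spinVec y i := by
      rw [spinVec_flipAt]; simp; ring
    simp only [mulVec_spinVec_flipAt, hd i, hs]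
    ring
  have hpt : ∀ y, Real.exp (spinEnergy M y) * (1 - ∑ i, ((1 / 2) * M.mulVec (spinVec y) i +
          2 * ((M * M).mulVec (spinVec y) i - (M * M) i i * spinVec y i)) *
        (spinVec y i - Real.tanh (M.mulVec (spinVec y) i))) ≤ Real.exp (4 * δ * n) := by
    intro y
    have h1 := spinEnergy_le hM hδ hρ y
    have h2 := Real.add_one_le_exp (4 * δ * n - spinEnergy M y)
    calc _ ≤ Real.exp (spinEnergy M y) * Real.exp (4 * δ * n - spinEnergy M y) := by
          apply mul_le_mul_of_nonneg_left _ (Real.exp_pos _).le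
          linarith
      _ = _ := by rw [← Real.exp_add]; ring_nf
  have h := Finset.sum_le_sum fun y (_ : y ∈ Finset.univ) => hpt y
  simp only [mul_sub (Real.exp _), mul_one, Finset.sum_sub_distrib, hzero, sub_zero] at h
  simpa using h

theorem pottsPhi_smul_one {n : ℕ} (A : Matrix (Fin n) (Fin n) ℝ) (β : ℝ) :
    pottsPhi A (β • (1 : Matrix (Fin 2) (Fin 2) ℝ)) (0 : Fin 2 → ℝ) =
      β / 4 * ∑ i, ∑ j, A i j + Real.log (∑ y, Real.exp (spinEnergy ((β / 2) • A) y)) := by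
  have hH : ∀ y : Fin n → Fin 2, pottsH A (β • (1 : Matrix (Fin 2) (Fin 2) ℝ)) 0 y =
      β / 4 * ∑ i, ∑ j, A i j + spinEnergy ((β / 2) • A) y := by
    intro y
    have hk : ∀ k l : Fin 2, (1 : Matrix (Fin 2) (Fin 2) ℝ) k l =
        (1 + isingSpin k * isingSpin l) / 2 := by
      intro k l
      fin_cases k <;> fin_cases l <;> simp [isingSpin]
    simp only [pottsH, spinEnergy, dotProduct, Matrix.mulVec, Matrix.smul_apply, hk, smul_eq_mul,
      Finset.mul_sum, Pi.zero_apply, Finset.sum_const_zero, add_zero, ← Finset.sum_add_distrib,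
      spinVec]
    refine Finset.sum_congr rfl fun i _ => Finset.sum_congr rfl fun j _ => ?_
    ring
  have hpos : (0 : ℝ) < ∑ y, Real.exp (spinEnergy ((β / 2) • A) y) :=
    Finset.sum_pos (fun y _ => Real.exp_pos _) Finset.univ_nonempty
  unfold pottsPhi
  simp only [hH, Real.exp_add, ← Finset.mul_sum]
  rw [Real.log_mul (Real.exp_pos _).ne' hpos.ne', Real.log_exp]

section Biregular

open scoped Classical

variable {n : ℕ} {G : SimpleGraph (Fin n)} {S : Finset (Fin n)} {c d : ℕ}

theorem scaledAdj_isSymm (G : SimpleGraph (Fin n)) (t : ℝ) : (scaledAdj G t).IsSymm := by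
  ext i j
  simp [scaledAdj, G.adj_comm]

theorem sum_scaledAdj_row (G : SimpleGraph (Fin n)) (t : ℝ) (i : Fin n) :
    ∑ j, scaledAdj G t i j = vertexDegree G i * t := by
  simp [scaledAdj, vertexDegree, ← Finset.sum_filter, ← SimpleGraph.neighborFinset_eq_filter]

theorem scaledAdj_mul_self_diag (G : SimpleGraph (Fin n)) (t : ℝ) (i : Fin n) :
    (scaledAdj G t * scaledAdj G t) i i = vertexDegree G i * t ^ 2 := by
  rw [← sum_scaledAdj_row, Matrix.mul_apply]
  refine Finset.sum_congr rfl fun j _ => ?_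
  simp only [scaledAdj, G.adj_comm j i]
  split_ifs <;> ring

theorem scaledAdj_mulVec_sq_le (G : SimpleGraph (Fin n)) (t : ℝ) (v : Fin n → ℝ) (i : Fin n) :
    (scaledAdj G t).mulVec v i ^ 2 ≤
      t ^ 2 * (vertexDegree G i * ∑ j, if G.Adj i j then v j ^ 2 else 0) := by
  have h1 : (scaledAdj G t).mulVec v i = t * ∑ j ∈ G.neighborFinset i, v j := by
    rw [SimpleGraph.neighborFinset_eq_filter, Finset.sum_filter, Finset.mul_sum]
    simp [scaledAdj, Matrix.mulVec, dotProduct]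
  rw [h1, mul_pow, ← Finset.sum_filter, ← SimpleGraph.neighborFinset_eq_filter]
  exact mul_le_mul_of_nonneg_left sq_sum_le_card_mul_sum_sq (sq_nonneg t)

theorem sum_scaledAdj_mulVec_sq_le
    (hbip : ∀ i j : Fin n, G.Adj i j → (i ∈ S ↔ j ∉ S))
    (hc : ∀ v ∈ S, vertexDegree G v = c) (hd : ∀ v, v ∉ S → vertexDegree G v = d)
    (t : ℝ) (v : Fin n → ℝ) :
    ∑ i, (scaledAdj G t).mulVec v i ^ 2 ≤ t ^ 2 * (c * d) * ∑ i, v i ^ 2 := by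
  calc _ ≤ ∑ i, t ^ 2 * (vertexDegree G i * ∑ j, if G.Adj i j then v j ^ 2 else 0) :=
        Finset.sum_le_sum fun i _ => scaledAdj_mulVec_sq_le G t v i
    _ = ∑ j, ∑ i, t ^ 2 * (vertexDegree G i * if G.Adj i j then v j ^ 2 else 0) := by
        simp only [Finset.mul_sum]
        exact Finset.sum_comm
    _ = ∑ j, t ^ 2 * (c * d) * v j ^ 2 := by
        refine Finset.sum_congr rfl fun j _ => ?_
        have hdeg : ∀ i, G.Adj i j → (vertexDegree G i : ℝ) * vertexDegree G j = c * d := by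
          intro i hij
          by_cases hi : i ∈ S
          · rw [hc i hi, hd j ((hbip i j hij).1 hi)]
          · have hj : j ∈ S := by by_contra hj; exact hi ((hbip i j hij).2 hj)
            rw [hd i hi, hc j hj, mul_comm]
        by_cases h0 : vertexDegree G j = 0
        · have hna : ∀ i, ¬ G.Adj i j := by
            intro i hij
            have : G.degree j = 0 := h0
            rw [← SimpleGraph.card_neighborFinset_eq_degree, Finset.card_eq_zero] at this
            have hm : i ∈ G.neighborFinset j := by simpa using hij.symm
            simp [this] at hm
          have hcd : (c : ℝ) * d = 0 := by
            by_cases hj : j ∈ S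
            · have := hc j hj; rw [h0] at this; simp [← this]
            · have := hd j hj; rw [h0] at this; simp [← this]
          simp [hna, hcd]
        · have h0' : (vertexDegree G j : ℝ) ≠ 0 := by exact_mod_cast h0
          have h1 : ∀ i, t ^ 2 * (vertexDegree G i * if G.Adj i j then v j ^ 2 else 0) =
              scaledAdj G 1 j i * (t ^ 2 * (c * d) * v j ^ 2 / vertexDegree G j) := by
            intro i
            simp only [scaledAdj, G.adj_comm j i]
            split_ifs with hij
            · rw [← hdeg i hij]; field_simp
            · simp
          simp only [h1]
          rw [← Finset.sum_mul, sum_scaledAdj_row]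
          field_simp
    _ = _ := by rw [Finset.mul_sum]

theorem sum_sum_scaledAdj (hc : ∀ v ∈ S, vertexDegree G v = c)
    (hd : ∀ v, v ∉ S → vertexDegree G v = d) (t : ℝ) :
    ∑ i, ∑ j, scaledAdj G t i j = (S.card * c + (n - S.card) * d) * t := by
  simp only [sum_scaledAdj_row]
  rw [← Finset.sum_mul, ← Finset.sum_add_sum_compl S]
  rw [Finset.sum_congr rfl fun i hi => by rw [hc i hi],
    Finset.sum_congr (s₁ := Sᶜ) rfl fun i hi => by rw [hd i (Finset.mem_compl.1 hi)]]
  have hle : S.card ≤ n := by simpa using S.card_le_univ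
  simp [Finset.card_compl, Nat.cast_sub hle]

end Biregular

theorem bipartite_ising_subcritical
    (G : (n : ℕ) → SimpleGraph (Fin n)) (S : (n : ℕ) → Finset (Fin n))
    (a c d : ℕ → ℕ)
    (hcard : ∀ n, (S n).card = a n)
    (hbip : ∀ n : ℕ, ∀ i j : Fin n, (G n).Adj i j → (i ∈ S n ↔ j ∉ S n))
    (hdeg1 : ∀ n : ℕ, ∀ v ∈ S n, vertexDegree (G n) v = c n)
    (hdeg2 : ∀ n : ℕ, ∀ v : Fin n, v ∉ S n → vertexDegree (G n) v = d n)
    (hedges : ∀ n, a n * c n = (n - a n) * d n)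
    (p : ℝ) (hp : p ∈ Set.Ioo (0 : ℝ) 1)
    (hap : Tendsto (fun n : ℕ => (a n : ℝ) / n) atTop (nhds p))
    (hcd : Tendsto (fun n : ℕ => c n + d n) atTop atTop)
    (β : ℝ) (hβ : β ^ 2 * p * (1 - p) ≤ 1) :
    Tendsto
      (fun n : ℕ =>
        pottsPhi (scaledAdj (G n) (1 / ((c n : ℝ) + (d n : ℝ))))
          (β • (1 : Matrix (Fin 2) (Fin 2) ℝ)) (0 : Fin 2 → ℝ) / n)
      atTop (nhds (β * p * (1 - p) / 2 + Real.log 2)) := by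
  have hle : ∀ n, a n ≤ n := fun n => by
    rw [← hcard n]; simpa using (S n).card_le_univ
  have hedges' : ∀ n, (a n : ℝ) * c n = (n - a n) * d n := fun n => by
    have h := hedges n
    rw [← Nat.cast_sub (hle n)]
    exact_mod_cast h
  have hcd' : Tendsto (fun n => ((c n : ℝ) + d n)) atTop atTop := by
    have h := (tendsto_natCast_atTop_atTop (R := ℝ)).comp hcd
    simpa [Function.comp_def] using h
  have hcfrac : ∀ n : ℕ, 0 < n → (0 : ℝ) < c n + d n →
      (c n : ℝ) / (c n + d n) = 1 - a n / n := by
    intro n hn h0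
    have hn' : (n : ℝ) ≠ 0 := by positivity
    field_simp
    linear_combination hedges' n
  have hdfrac : ∀ n : ℕ, 0 < n → (0 : ℝ) < c n + d n →
      (d n : ℝ) / (c n + d n) = a n / n := by
    intro n hn h0
    have h := hcfrac n hn h0
    have h2 : (c n : ℝ) / (c n + d n) + d n / (c n + d n) = 1 := by
      rw [← add_div, div_self h0.ne']
    linarith
  have hev : ∀ᶠ n : ℕ in atTop, 0 < n ∧ (0 : ℝ) < c n + d n :=
    (eventually_gt_atTop 0).and (hcd'.eventually_gt_atTop 0)
  have hlim : Tendsto (fun n : ℕ => (a n : ℝ) / n * (1 - a n / n)) atTop (nhds (p * (1 - p))) :=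
    hap.mul (tendsto_const_nhds.sub hap)
  have hρev : ∀ᶠ n : ℕ in atTop, β ^ 2 / 4 * ((a n : ℝ) / n * (1 - a n / n)) < 1 / 2 := by
    refine (hlim.const_mul (β ^ 2 / 4)).eventually_lt_const ?_
    linarith
  have hpositive : ∀ n : ℕ,
      (0 : ℝ) < ∑ y, Real.exp (spinEnergy ((β / 2) • scaledAdj (G n) (1 / ((c n : ℝ) + d n))) y) :=
    fun n => Finset.sum_pos (fun y _ => Real.exp_pos _) Finset.univ_nonempty
  have hdiag : ∀ (n : ℕ) (i : Fin n),
      ((β / 2) • scaledAdj (G n) (1 / ((c n : ℝ) + d n))) i i = 0 := by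
    intro n i
    simp [scaledAdj]
  have hbounds : ∀ᶠ n : ℕ in atTop, β / 2 * ((a n : ℝ) / n * (1 - a n / n)) + Real.log 2 ≤
      pottsPhi (scaledAdj (G n) (1 / ((c n : ℝ) + (d n : ℝ))))
          (β • (1 : Matrix (Fin 2) (Fin 2) ℝ)) (0 : Fin 2 → ℝ) / n ∧
      pottsPhi (scaledAdj (G n) (1 / ((c n : ℝ) + (d n : ℝ))))
          (β • (1 : Matrix (Fin 2) (Fin 2) ℝ)) (0 : Fin 2 → ℝ) / n ≤
        β / 2 * ((a n : ℝ) / n * (1 - a n / n)) + Real.log 2 + β ^ 2 * (1 / (c n + d n)) := by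
    filter_upwards [hev, hρev] with n hn hρ
    obtain ⟨hn, h0⟩ := hn
    have hn' : (0 : ℝ) < n := by exact_mod_cast hn
    have hc := hcfrac n hn h0
    have hd := hdfrac n hn h0
    have hmain : pottsPhi (scaledAdj (G n) (1 / ((c n : ℝ) + (d n : ℝ))))
          (β • (1 : Matrix (Fin 2) (Fin 2) ℝ)) (0 : Fin 2 → ℝ) / n =
        β / 2 * ((a n : ℝ) / n * (1 - a n / n)) + Real.log (∑ y, Real.exp (spinEnergy
          ((β / 2) • scaledAdj (G n) (1 / ((c n : ℝ) + d n))) y)) / n := by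
      rw [pottsPhi_smul_one, add_div, sum_sum_scaledAdj (hdeg1 n) (hdeg2 n), hcard n]
      congr 1
      have h1 : ((a n : ℝ) * c n + (n - a n) * d n) * (1 / (c n + d n)) =
          a n * (c n / (c n + d n)) + (n - a n) * (d n / (c n + d n)) := by ring
      rw [h1, hc, hd]
      field_simp
      ring
    have hsymm : ((β / 2) • scaledAdj (G n) (1 / ((c n : ℝ) + d n))).IsSymm :=
      (scaledAdj_isSymm _ _).smul _
    have hlow := two_pow_le_sum_exp_spinEnergy (hdiag n)
    have hup := sum_exp_spinEnergy_le hsymm (hdiag n)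
      (δ := β ^ 2 / 4 * (1 / (c n + d n))) (fun i => by
        have hdeg : (vertexDegree (G n) i : ℝ) ≤ c n + d n := by
          by_cases hi : i ∈ S n
          · rw [hdeg1 n i hi]; simp
          · rw [hdeg2 n i hi]; simp
        rw [Matrix.smul_mul, Matrix.mul_smul, Matrix.smul_apply, Matrix.smul_apply,
          scaledAdj_mul_self_diag, smul_eq_mul, smul_eq_mul]
        calc _ = β ^ 2 / 4 * (1 / (c n + d n)) * (vertexDegree (G n) i / (c n + d n)) := by ring
          _ ≤ β ^ 2 / 4 * (1 / (c n + d n)) * 1 := by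
            apply mul_le_mul_of_nonneg_left ((div_le_one h0).2 hdeg)
            positivity
          _ = _ := mul_one _)
      (fun v => by
        have h := sum_scaledAdj_mulVec_sq_le (hbip n) (hdeg1 n) (hdeg2 n)
          (1 / ((c n : ℝ) + d n)) v
        have h2 : (1 / ((c n : ℝ) + d n)) ^ 2 * (c n * d n) = a n / n * (1 - a n / n) := by
          rw [← hc, ← hd]; ring
        rw [h2] at h
        simp only [Matrix.smul_mulVec, Pi.smul_apply, smul_eq_mul, mul_pow, ← Finset.mul_sum]
        have hv : 0 ≤ ∑ i, v i ^ 2 := Finset.sum_nonneg fun i _ => sq_nonneg _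
        calc _ ≤ (β / 2) ^ 2 * (a n / n * (1 - a n / n) * ∑ i, v i ^ 2) :=
              mul_le_mul_of_nonneg_left h (sq_nonneg _)
          _ = (β ^ 2 / 4 * (a n / n * (1 - a n / n))) * ∑ i, v i ^ 2 := by ring
          _ ≤ _ := mul_le_mul_of_nonneg_right hρ.le hv)
    rw [hmain]
    have hl1 := Real.log_le_log (by positivity) hlow
    have hl2 := Real.log_le_log (hpositive n) hup
    rw [Real.log_pow] at hl1
    rw [Real.log_mul (by positivity) (Real.exp_pos _).ne', Real.log_pow, Real.log_exp] at hl2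
    constructor
    · rw [add_le_add_iff_left, le_div_iff₀ hn']
      linarith
    · rw [add_assoc, add_le_add_iff_left, div_le_iff₀ hn']
      linarith
  have hinv : Tendsto (fun n : ℕ => β ^ 2 * (1 / ((c n : ℝ) + d n))) atTop (nhds 0) := by
    simpa using (hcd'.inv_tendsto_atTop).const_mul (β ^ 2)
  have hL : Tendsto (fun n : ℕ => β / 2 * ((a n : ℝ) / n * (1 - a n / n)) + Real.log 2) atTop
      (nhds (β * p * (1 - p) / 2 + Real.log 2)) := by
    convert (hlim.const_mul (β / 2)).add_const (Real.log 2) using 2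
    ring
  refine tendsto_of_tendsto_of_tendsto_of_le_of_le' hL (by simpa only [add_zero] using hL.add hinv) ?_ ?_
  · filter_upwards [hbounds] with n h using h.1
  · filter_upwards [hbounds] with n h using h.2
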